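/- Let k be a field, A a finitely generated commutative k-algebra, and σ : A → A a k-algebra involution. Let L_A = {a − σ(a) : a ∈ A}, an A^σ-submodule of A, and let I_A be the ideal of A generated by L_A. Assume I_A is an invertible ideal (a finitely generated projective A-module of rank one). Then L_A is a finitely generated projective A^σ-module of rank one (i.e. L_A is finite projective over A^σ and locally free of rank 1 at every prime of A^σ). -/

import Mathlib

/-- The fixed subring `A^σ` of a ring involution `σ`. -/
def fixedSubring {A : Type*} [CommRing A] (σ : A →+* A) : Subring A where
  carrier := {a | σ a = a}
  mul_mem' := fun {a b} ha hb => by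
    simp only [Set.mem_setOf_eq] at *; rw [map_mul, ha, hb]
  one_mem' := by simp only [Set.mem_setOf_eq, map_one]
  add_mem' := fun {a b} ha hb => by
    simp only [Set.mem_setOf_eq] at *; rw [map_add, ha, hb]
  zero_mem' := by simp only [Set.mem_setOf_eq, map_zero]
  neg_mem' := fun {a} ha => by
    simp only [Set.mem_setOf_eq] at *; rw [map_neg, ha]

/-- `L_A = {a - σ a : a ∈ A}` as an `A^σ`-submodule of `A`. -/
def lsub {A : Type*} [CommRing A] (σ : A →+* A) : Submodule (fixedSubring σ) A where
  carrier := Set.range fun a => a - σ a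
  add_mem' := by
    rintro _ _ ⟨a, rfl⟩ ⟨b, rfl⟩
    exact ⟨a + b, by simp only []; rw [map_add]; ring⟩
  zero_mem' := ⟨0, by simp⟩
  smul_mem' := by
    rintro ⟨c, hc⟩ _ ⟨a, rfl⟩
    refine ⟨c * a, ?_⟩
    have hc' : σ c = c := hc
    show c * a - σ (c * a) = c • (a - σ a)
    rw [map_mul, hc']
    show c * a - c * σ a = c * (a - σ a)
    ring

/-- The ideal `I_A` of `A` generated by `L_A = {a - σ a : a ∈ A}`. -/
def iideal {A : Type*} [CommRing A] (σ : A →+* A) : Ideal A :=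
  Ideal.span (Set.range fun a => a - σ a)

/-- An ideal is invertible if it is a finitely generated projective module of rank one. -/
def IsInvertibleIdeal {A : Type*} [CommRing A] (I : Ideal A) : Prop :=
  Module.Finite A I ∧ Module.Projective A I ∧
    ∀ p : PrimeSpectrum A, Module.rankAtStalk (R := A) I p = 1


/-- A module with commuting contraction and surjective evaluation is invertible. -/
theorem invertible_of_eval {R M : Type*} [CommRing R] [AddCommGroup M] [Module R M]
    (hc : ∀ (f : Module.Dual R M) (x y : M), f x • y = f y • x)
    (hs : Function.Surjective (contractLeft R M)) : Module.Invertible R M := by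
  refine ⟨⟨?_, hs⟩⟩
  obtain ⟨t, ht⟩ := hs 1
  have key : ∀ u : TensorProduct R (Module.Dual R M) M, u = contractLeft R M u • t := by
    have h2 : ∀ (h : Module.Dual R M) (y : M) (v : TensorProduct R (Module.Dual R M) M),
        contractLeft R M v • (h ⊗ₜ[R] y) = h y • v := by
      intro h y v
      induction v using TensorProduct.induction_on with
      | zero => simp
      | add a b ha hb => rw [map_add, add_smul, ha, hb, smul_add]
      | tmul f x =>
        rw [contractLeft_apply, ← TensorProduct.tmul_smul, hc f x y, TensorProduct.tmul_smul,
          TensorProduct.smul_tmul', TensorProduct.smul_tmul']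
        congr 1
        ext z
        simp only [LinearMap.smul_apply, smul_eq_mul]
        have := congrArg h (hc f y z)
        simp only [map_smul, smul_eq_mul] at this
        rw [this, mul_comm]
    intro u
    induction u using TensorProduct.induction_on with
    | zero => simp
    | add a b ha hb => rw [map_add, add_smul, ← ha, ← hb]
    | tmul h y =>
      have := h2 h y t
      rw [ht, one_smul] at this
      rw [contractLeft_apply, ← this]
  intro u v huv
  rw [key u, key v, huv]

theorem invertible_of_span {R M : Type*} [CommRing R] [AddCommGroup M] [Module R M]
    (hT : Ideal.span {c : R | ∃ (h : Module.Dual R M) (z : M),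
      (∀ x y : M, h x • y = h y • x) ∧ h z = c} = ⊤) : Module.Invertible R M := by
  refine invertible_of_eval (fun f x y => ?_) ?_
  · have hmem : (1 : R) ∈ Ideal.span {c : R | ∃ (h : Module.Dual R M) (z : M),
      (∀ x y : M, h x • y = h y • x) ∧ h z = c} := hT ▸ trivial
    have key : ∀ c ∈ Ideal.span {c : R | ∃ (h : Module.Dual R M) (z : M),
        (∀ x y : M, h x • y = h y • x) ∧ h z = c}, c • f x • y = c • f y • x := by
      intro c hc
      induction hc using Submodule.span_induction with
      | mem c hc =>
        obtain ⟨h, z, hh, rfl⟩ := hc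
        have e : ∀ w, h z * f w = h w * f z := fun w => by
          have := congrArg f (hh z w)
          simpa only [map_smul, smul_eq_mul] using this
        rw [smul_smul, smul_smul, e, e, mul_comm, mul_smul, hh x y, ← mul_smul, mul_comm]
      | zero => simp
      | add a b _ _ ha hb => rw [add_smul, ha, hb, add_smul]
      | smul r a _ ha => rw [smul_assoc, ha, smul_assoc]
    simpa using key 1 hmem
  · have hr : (⊤ : Ideal R) ≤ LinearMap.range (contractLeft R M) := by
      rw [← hT]
      refine Ideal.span_le.mpr ?_
      rintro _ ⟨h, z, -, rfl⟩
      exact ⟨h ⊗ₜ z, contractLeft_apply _ _⟩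
    exact LinearMap.range_eq_top.mp (top_le_iff.mp hr)

theorem dual_mul_comm {A : Type*} [CommRing A] (I : Ideal A) (g : Module.Dual A I) (x y : I) :
    g x * (y : A) = g y * (x : A) := by
  have h : (y : A) • x = (x : A) • y := by
    ext; simp [mul_comm]
  have := congrArg g h
  simp only [map_smul, smul_eq_mul] at this
  rw [mul_comm, this, mul_comm]

theorem dual_dual_comm {A : Type*} [CommRing A] (I : Ideal A) (g g' : Module.Dual A I) (x y : I) :
    g x * g' y = g y * g' x := by
  have h : g x • y = g y • x := Subtype.ext (dual_mul_comm I g x y)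
  have := congrArg g' h
  simpa only [map_smul, smul_eq_mul] using this

theorem exists_dual_notMem {A : Type*} [CommRing A] (I : Ideal A) (hI : IsInvertibleIdeal I)
    (P : Ideal A) [hP : P.IsPrime] : ∃ (g : Module.Dual A I) (x : I), g x ∉ P := by
  obtain ⟨hf, hp, hr⟩ := hI
  by_contra! hcon
  have hle : (⊤ : Submodule A I) ≤ P • ⊤ := by
    intro x _
    obtain ⟨s, hs⟩ := Module.projective_def.mp hp
    rw [← hs x, Finsupp.linearCombination_apply]
    refine Submodule.sum_mem _ fun i _ => Submodule.smul_mem_smul ?_ trivial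
    exact hcon (Finsupp.lapply i ∘ₗ s) x
  obtain ⟨r, hr1, hr0⟩ := Submodule.exists_sub_one_mem_and_smul_eq_zero_of_fg_of_le_smul P ⊤
    hf.fg_top hle
  have h0 := (Module.rankAtStalk_pos_iff_mem_support (M := I) ⟨P, hP⟩).mp
    (by rw [hr]; exact one_pos)
  refine absurd h0 (Module.notMem_support_iff'.mpr fun m => ⟨r, ?_, hr0 m trivial⟩)
  intro hrP
  apply hP.ne_top
  rw [Ideal.eq_top_iff_one]
  simpa using P.sub_mem hrP hr1

section
variable {A : Type*} [CommRing A] (σ : A →+* A)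

theorem lsub_le_iideal {x : A} (hx : x ∈ lsub σ) : x ∈ iideal σ := Ideal.subset_span hx

theorem sigma_lsub (hσ : ∀ a : A, σ (σ a) = a)
    {x : A} (hx : x ∈ lsub σ) : σ x = -x := by
  obtain ⟨a, rfl⟩ := hx
  simp [hσ]

theorem sigma_iideal (hσ : ∀ a : A, σ (σ a) = a)
    {x : A} (hx : x ∈ iideal σ) : σ x ∈ iideal σ := by
  have : iideal σ ≤ (iideal σ).comap σ := by
    refine Ideal.span_le.mpr ?_
    intro y hy
    change σ y ∈ iideal σ
    rw [sigma_lsub σ hσ (x := y) hy]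
    exact neg_mem (Ideal.subset_span hy)
  exact this hx

/-- The conjugate `σ ∘ g ∘ σ`. -/
def conjDual (hσ : ∀ a : A, σ (σ a) = a)
    (g : Module.Dual A (iideal σ)) : Module.Dual A (iideal σ) where
  toFun x := σ (g ⟨σ x, sigma_iideal σ hσ x.2⟩)
  map_add' x y := by
    rw [← map_add, ← map_add]; congr 2; ext; simp
  map_smul' a x := by
    have : (⟨σ (a • x : iideal σ), sigma_iideal σ hσ (a • x).2⟩ : iideal σ)
      = σ a • ⟨σ x, sigma_iideal σ hσ x.2⟩ := by ext; simp
    rw [this, map_smul, smul_eq_mul, map_mul, hσ]; rfl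

theorem sigma_dual (hσ : ∀ a : A, σ (σ a) = a)
    (g : Module.Dual A (iideal σ)) (x : A) (hx : x ∈ lsub σ) :
    σ (g ⟨x, lsub_le_iideal σ hx⟩) = - conjDual σ hσ g ⟨x, lsub_le_iideal σ hx⟩ := by
  rw [← map_neg]
  change _ = σ (g _)
  congr 2
  ext
  simp [sigma_lsub σ hσ hx]

/-- The functional `x ↦ g x * σ (g e)` on `L`. -/
def lfun (hσ : ∀ a : A, σ (σ a) = a)
    (g : Module.Dual A (iideal σ)) (e : lsub σ) : Module.Dual (fixedSubring σ) (lsub σ) where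
  toFun x := ⟨g ⟨x, lsub_le_iideal σ x.2⟩ * σ (g ⟨e, lsub_le_iideal σ e.2⟩), by
    change σ _ = _
    rw [map_mul, hσ, sigma_dual σ hσ g x x.2, sigma_dual σ hσ g e e.2, neg_mul, mul_neg,
      mul_comm, dual_dual_comm]⟩
  map_add' x y := by
    ext
    change g _ * _ = g _ * _ + g _ * _
    rw [← add_mul, ← map_add]; rfl
  map_smul' c x := by
    ext
    change g _ * _ = (c : A) * (g _ * _)
    rw [← mul_assoc, ← smul_eq_mul (c : A) (g _), ← map_smul]; rfl

theorem isIntegral_fixed (hσ : ∀ a : A, σ (σ a) = a)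
    : Algebra.IsIntegral (fixedSubring σ) A := by
  refine ⟨fun a => ?_⟩
  let s : fixedSubring σ := ⟨a + σ a, by change σ _ = _; rw [map_add, hσ, add_comm]⟩
  let s' : fixedSubring σ := -s
  let n : fixedSubring σ := ⟨a * σ a, by change σ _ = _; rw [map_mul, hσ, mul_comm]⟩
  refine ⟨Polynomial.X ^ 2 + (Polynomial.C s' * Polynomial.X + Polynomial.C n), ?_, ?_⟩
  · refine Polynomial.monic_X_pow_add ?_
    exact lt_of_le_of_lt Polynomial.degree_linear_le (by norm_num)
  · simp only [Polynomial.eval₂_add, Polynomial.eval₂_mul, Polynomial.eval₂_pow,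
      Polynomial.eval₂_X, Polynomial.eval₂_C]
    change a ^ 2 + (-(a + σ a) * a + a * σ a) = 0
    ring

theorem exists_good (hσ : ∀ a : A, σ (σ a) = a)
    (hpure : IsInvertibleIdeal (iideal σ)) (P : Ideal A) [hP : P.IsPrime] :
    ∃ (g : Module.Dual A (iideal σ)) (d : lsub σ),
      g ⟨d, lsub_le_iideal σ d.2⟩ * σ (g ⟨d, lsub_le_iideal σ d.2⟩) ∉ P := by
  by_cases h : ∃ d : lsub σ, (d : A) ∉ P
  · obtain ⟨d, hd⟩ := h
    refine ⟨(iideal σ).subtype, d, fun hm => ?_⟩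
    change (d : A) * σ d ∈ P at hm
    rw [sigma_lsub σ hσ d.2, mul_neg, neg_mem_iff] at hm
    exact (hP.mem_or_mem hm).elim hd hd
  · push Not at h
    have hst : ∀ a, σ a ∈ P → a ∈ P := by
      intro a ha
      have := P.add_mem (h ⟨a - σ a, a, rfl⟩) ha
      simpa using this
    obtain ⟨g, x, hx⟩ := exists_dual_notMem _ hpure P
    by_cases hd : ∃ d : lsub σ, g ⟨d, lsub_le_iideal σ d.2⟩ ∉ P
    · obtain ⟨d, hd⟩ := hd
      exact ⟨g, d, fun hm => (hP.mem_or_mem hm).elim hd fun h' => hd (hst _ h')⟩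
    · exfalso
      push Not at hd
      apply hx
      have : ∀ y (hy : y ∈ iideal σ), g ⟨y, hy⟩ ∈ P := by
        intro y hy
        induction hy using Submodule.span_induction with
        | mem y hy => exact hd ⟨y, hy⟩
        | zero => exact (map_zero g).symm ▸ P.zero_mem
        | add a b ha hb h1 h2 =>
          have := P.add_mem h1 h2
          rw [← map_add] at this
          exact this
        | smul c a ha h1 =>
          have := P.mul_mem_left c h1
          rw [← smul_eq_mul, ← map_smul] at this
          exact this
      exact this x x.2

theorem lsub_invertible (hσ : ∀ a : A, σ (σ a) = a)
    (hpure : IsInvertibleIdeal (iideal σ)) :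
    Module.Invertible (fixedSubring σ) (lsub σ) := by
  have hint := isIntegral_fixed σ hσ
  apply invertible_of_span
  by_contra hne
  obtain ⟨p, hp, hle⟩ := Ideal.exists_le_maximal _ hne
  obtain ⟨P, -, hP, hPp⟩ := Ideal.exists_ideal_over_prime_of_isIntegral p (⊥ : Ideal A) (by
    intro x hx
    have hx0 : (x : A) = 0 := hx
    rw [show x = 0 from Subtype.ext hx0]
    exact p.zero_mem)
  obtain ⟨g, d, hgd⟩ := exists_good σ hσ hpure P
  apply hgd
  have hm : lfun σ hσ g d d ∈ p := by
    refine hle (Ideal.subset_span ⟨lfun σ hσ g d, d, fun x y => ?_, rfl⟩)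
    ext
    change g ⟨x, lsub_le_iideal σ x.2⟩ * _ * (y : A) = g ⟨y, lsub_le_iideal σ y.2⟩ * _ * (x : A)
    have := dual_mul_comm _ g ⟨x, lsub_le_iideal σ x.2⟩ ⟨y, lsub_le_iideal σ y.2⟩
    rw [mul_right_comm, this, mul_right_comm]
  rw [← hPp] at hm
  exact hm
end

theorem free_localized (R M : Type*) [CommRing R] [AddCommGroup M] [Module R M]
    [Module.Invertible R M] (p : PrimeSpectrum R) :
    Module.Free (Localization.AtPrime p.asIdeal) (LocalizedModule p.asIdeal.primeCompl M) := by
  have : Module.Finite (Localization.AtPrime p.asIdeal)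
      (LocalizedModule p.asIdeal.primeCompl M) := inferInstance
  have : Module.Flat (Localization.AtPrime p.asIdeal)
      (LocalizedModule p.asIdeal.primeCompl M) := inferInstance
  exact Module.free_of_flat_of_isLocalRing

/-- If `(A, σ)` is a pure involution of a finitely generated algebra over a field `k`
(`I_A` is an invertible ideal), then `L_A = {a - σ a : a ∈ A}` is a finitely generated
projective module of rank one over the fixed subring `A^σ`. -/
theorem pure_involution_lmodule_rank_one
    {k : Type*} [Field k] {A : Type*} [CommRing A] [Algebra k A] [Algebra.FiniteType k A]
    (σ : A →ₐ[k] A) (hσ : ∀ a : A, σ (σ a) = a)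
    (hpure : IsInvertibleIdeal (iideal σ.toRingHom)) :
    Module.Finite (fixedSubring σ.toRingHom) (lsub σ.toRingHom) ∧
      Module.Projective (fixedSubring σ.toRingHom) (lsub σ.toRingHom) ∧
      ∀ p : PrimeSpectrum (fixedSubring σ.toRingHom),
        Module.Free (Localization.AtPrime p.asIdeal)
            (LocalizedModule p.asIdeal.primeCompl (lsub σ.toRingHom)) ∧
          Module.rankAtStalk (R := fixedSubring σ.toRingHom) (lsub σ.toRingHom) p = 1 := by
  have hinv := lsub_invertible σ.toRingHom hσ hpure
  refine ⟨inferInstance, inferInstance, fun p => ?_⟩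
  have hfree : Module.Free (Localization.AtPrime p.asIdeal)
      (LocalizedModule p.asIdeal.primeCompl (lsub σ.toRingHom)) :=
    free_localized _ _ p
  exact ⟨hfree, Module.Invertible.finrank_eq_one _ _⟩
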